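/- arXiv:2312.08057 — 3 statements merged into one kernel-verified Lean document; each statement's English description precedes it below -/
import Mathlib

section
/- Let Ω be a finite ground set with |Ω| = n, let f : 2^Ω → ℝ be monotone and submodular, let k ≥ 1 be an integer, let S* ⊆ Ω with |S*| ≤ k, let S ⊆ Ω, and let ε ∈ (0,1). Let s be a positive integer with (n − |S|)·log(1/ε)/k ≤ s ≤ n − |S|, and let A be a subset of Ω∖S of cardinality s chosen uniformly at random among all such subsets. Then E_A[ max_{a ∈ A} f(S ∪ {a}) ] − f(S) ≥ ((1−ε)/k)·( f(S*) − f(S) ). -/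
open Finset in
/-- Telescoped submodularity: the gain of a set is at most the sum of its marginal gains. -/
theorem sub_le_sum_marginal {α : Type*} [DecidableEq α] {Ω : Finset α} {f : Finset α → ℝ}
    (hsub : ∀ A B : Finset α, A ⊆ B → B ⊆ Ω → ∀ x ∈ Ω, x ∉ B →
      f (insert x A) - f A ≥ f (insert x B) - f B)
    {S : Finset α} (hS : S ⊆ Ω) (T : Finset α) (hT : T ⊆ Ω \ S) :
    f (T ∪ S) - f S ≤ ∑ a ∈ T, (f (insert a S) - f S) := by
  induction T using Finset.induction_on with
  | empty => simp
  | insert x T hx ih =>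
    have hxΩ := mem_sdiff.mp (hT (mem_insert_self x T))
    have hTΩ : T ⊆ Ω \ S := (subset_insert x T).trans hT
    have hstep := hsub S (T ∪ S) subset_union_right
      (union_subset (hTΩ.trans sdiff_subset) hS) x hxΩ.1 (by simp [hx, hxΩ.2])
    rw [sum_insert hx, insert_union]
    linarith [ih hTΩ]

open Finset in
theorem sum_powersetCard_mem_symm {α : Type*} [DecidableEq α] {U T : Finset α} (hTU : T ⊆ U)
    (s : ℕ) (w : ℕ → ℝ) {a b : α} (ha : a ∈ T) (hb : b ∈ T) :
    ∑ A ∈ U.powersetCard s with a ∈ A, w (A ∩ T).card =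
      ∑ A ∈ U.powersetCard s with b ∈ A, w (A ∩ T).card := by
  have hmap : ∀ V : Finset α, T ⊆ V → V.map (Equiv.swap a b).toEmbedding = V := by
    intro V hV
    refine map_perm fun x hx => ?_
    rcases (Equiv.swap_apply_ne_self_iff.mp hx).2 with rfl | rfl
    exacts [hV ha, hV hb]
  have hinv : ∀ A : Finset α,
      (A.map (Equiv.swap a b).toEmbedding).map (Equiv.swap a b).toEmbedding = A := by
    intro A
    ext x
    simp
  have hmem : ∀ A ∈ U.powersetCard s, A.map (Equiv.swap a b).toEmbedding ∈ U.powersetCard s := by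
    intro A hA
    rw [mem_powersetCard] at hA ⊢
    refine ⟨?_, by rw [card_map, hA.2]⟩
    rw [← hmap U hTU]
    exact map_subset_map.mpr hA.1
  refine sum_nbij' (fun A => A.map (Equiv.swap a b).toEmbedding)
    (fun A => A.map (Equiv.swap a b).toEmbedding) ?_ ?_ (fun A _ => hinv A) (fun A _ => hinv A) ?_
  · intro A hA
    rw [mem_filter] at hA ⊢
    exact ⟨hmem A hA.1, mem_map.mpr ⟨a, hA.2, by simp⟩⟩
  · intro A hA
    rw [mem_filter] at hA ⊢
    exact ⟨hmem A hA.1, mem_map.mpr ⟨b, hA.2, by simp⟩⟩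
  · intro A _
    conv_rhs => rw [← hmap T subset_rfl, ← map_inter, card_map]

open Finset in
/-- Averaging over the part of a uniformly random `s`-subset that lies in `T` weighs all elements
of `T` equally. -/
theorem card_mul_sum_average_inter {α : Type*} [DecidableEq α] {U T : Finset α} (hTU : T ⊆ U)
    (s : ℕ) (g : α → ℝ) :
    (T.card : ℝ) * ∑ A ∈ U.powersetCard s, ((A ∩ T).card : ℝ)⁻¹ * ∑ a ∈ A ∩ T, g a =
      ((U.card.choose s : ℝ) - ((U.card - T.card).choose s : ℝ)) * ∑ a ∈ T, g a := by
  set W : α → ℝ := fun a => ∑ A ∈ U.powersetCard s with a ∈ A, ((A ∩ T).card : ℝ)⁻¹ with hW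
  have hswap : ∀ h : α → ℝ,
      ∑ A ∈ U.powersetCard s, ((A ∩ T).card : ℝ)⁻¹ * ∑ a ∈ A ∩ T, h a = ∑ a ∈ T, W a * h a := by
    intro h
    simp_rw [hW, sum_mul, mul_sum, sum_filter]
    rw [sum_comm]
    refine sum_congr rfl fun A _ => ?_
    rw [inter_comm, ← filter_mem_eq_inter, sum_filter]
  have htotal : ∑ a ∈ T, W a = (U.card.choose s : ℝ) - ((U.card - T.card).choose s : ℝ) := by
    have h1 := hswap fun _ => 1
    simp only [mul_one, sum_const, nsmul_eq_mul] at h1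
    rw [← h1]
    have h2 : ∀ A ∈ U.powersetCard s, ((A ∩ T).card : ℝ)⁻¹ * ((A ∩ T).card : ℝ) =
        1 - if Disjoint A T then 1 else 0 := by
      intro A _
      by_cases hd : Disjoint A T
      · simp [hd, disjoint_iff_inter_eq_empty.mp hd]
      · rw [if_neg hd, sub_zero]
        refine inv_mul_cancel₀ ?_
        rw [disjoint_iff_inter_eq_empty] at hd
        simpa using hd
    have h3 : (U.powersetCard s).filter (fun A => Disjoint A T) = (U \ T).powersetCard s := by
      ext A
      simp only [mem_filter, mem_powersetCard, subset_sdiff]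
      tauto
    rw [sum_congr rfl h2, sum_sub_distrib, ← sum_filter, h3]
    simp [card_sdiff_of_subset hTU]
  have hconst : ∀ a ∈ T, (T.card : ℝ) * W a = ∑ b ∈ T, W b := by
    intro a ha
    rw [← nsmul_eq_mul, ← sum_const]
    exact sum_congr rfl fun b hb =>
      sum_powersetCard_mem_symm hTU s (fun m => (m : ℝ)⁻¹) ha hb
  rw [hswap, mul_sum, ← htotal, mul_sum]
  refine sum_congr rfl fun a ha => ?_
  rw [← mul_assoc, hconst a ha]

theorem descFactorial_mul_pow_le {M N : ℕ} (h : M ≤ N) (s : ℕ) :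
    M.descFactorial s * N ^ s ≤ N.descFactorial s * M ^ s := by
  induction s with
  | zero => simp
  | succ s ih =>
    have hstep : (M - s) * N ≤ (N - s) * M := by
      rw [Nat.sub_mul, Nat.sub_mul, mul_comm M N]
      exact Nat.sub_le_sub_left (Nat.mul_le_mul_left s h) _
    calc M.descFactorial (s + 1) * N ^ (s + 1)
        = ((M - s) * N) * (M.descFactorial s * N ^ s) := by
          rw [Nat.descFactorial_succ, pow_succ]; ring
      _ ≤ ((N - s) * M) * (N.descFactorial s * M ^ s) := Nat.mul_le_mul hstep ih
      _ = N.descFactorial (s + 1) * M ^ (s + 1) := by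
          rw [Nat.descFactorial_succ, pow_succ]; ring

theorem choose_sub_le_exp_mul_choose {N t : ℕ} (hN : 0 < N) (ht : t ≤ N) (s : ℕ) :
    ((N - t).choose s : ℝ) ≤ Real.exp (-(t * s / N : ℝ)) * N.choose s := by
  have hNR : (0 : ℝ) < N := by exact_mod_cast hN
  have hnat : (N - t).choose s * N ^ s ≤ N.choose s * (N - t) ^ s := by
    have h := descFactorial_mul_pow_le (Nat.sub_le N t) s
    rw [Nat.descFactorial_eq_factorial_mul_choose, Nat.descFactorial_eq_factorial_mul_choose,
      mul_assoc, mul_assoc] at h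
    exact Nat.le_of_mul_le_mul_left h s.factorial_pos
  have hreal : ((N - t).choose s : ℝ) * (N : ℝ) ^ s ≤ N.choose s * ((N : ℝ) - t) ^ s := by
    rw [← Nat.cast_sub ht]
    exact_mod_cast hnat
  have hbase : ((N : ℝ) - t) ≤ N * Real.exp (-(t / N : ℝ)) := by
    have h := mul_le_mul_of_nonneg_left (Real.add_one_le_exp (-(t / N : ℝ))) hNR.le
    have h' : (N : ℝ) * (-(t / N : ℝ) + 1) = N - t := by field_simp; ring
    linarith
  have hpow : ((N : ℝ) - t) ^ s ≤ (N : ℝ) ^ s * Real.exp (-(t * s / N : ℝ)) := by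
    have h0 : (0 : ℝ) ≤ (N : ℝ) - t := sub_nonneg.mpr (by exact_mod_cast ht)
    calc ((N : ℝ) - t) ^ s ≤ (N * Real.exp (-(t / N : ℝ))) ^ s := pow_le_pow_left₀ h0 hbase s
      _ = (N : ℝ) ^ s * Real.exp (-(t * s / N : ℝ)) := by
        rw [mul_pow, ← Real.exp_nat_mul]
        congr 2
        ring
  have hmul := mul_le_mul_of_nonneg_left hpow (Nat.cast_nonneg (α := ℝ) (N.choose s))
  refine le_of_mul_le_mul_right ?_ (pow_pos hNR s)
  linarith

/-- Convexity of the exponential, between the exponents `0` and `x`. -/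
theorem exp_neg_mul_le {x θ ε : ℝ} (hε : 0 < ε) (hx : Real.log (1 / ε) ≤ x) (h0 : 0 ≤ θ)
    (h1 : θ ≤ 1) : Real.exp (-(θ * x)) ≤ 1 - θ * (1 - ε) := by
  have hexp : Real.exp (-x) ≤ ε := by
    rw [one_div, Real.log_inv] at hx
    rw [← Real.le_log_iff_exp_le hε]
    linarith
  have hconv := convexOn_exp.2 (Set.mem_univ 0) (Set.mem_univ (-x)) (sub_nonneg.mpr h1) h0
    (sub_add_cancel 1 θ)
  simp only [smul_eq_mul, mul_zero, zero_add, Real.exp_zero, mul_one, mul_neg] at hconv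
  nlinarith [mul_le_mul_of_nonneg_left hexp h0]


/-- stochastic-greedy sampling lemma, Lemma 2 of Mirzasoleiman et al. 2015.
For a monotone submodular `f` on a ground set `Ω` with `|Ω| = n`, an optimal set `S*` with
`|S*| ≤ k`, a current set `S ⊆ Ω`, `ε ∈ (0,1)`, and a sample size `s` with
`(n − |S|)·log(1/ε)/k ≤ s ≤ n − |S|`, the expectation over a uniformly random size-`s`
subset `A ⊆ Ω∖S` of `max_{a ∈ A} f(S ∪ {a})` satisfies
`E_A[max_{a∈A} f(S∪{a})] − f(S) ≥ ((1−ε)/k)·(f(S*) − f(S))`. -/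
theorem stmt2 {α : Type*} [DecidableEq α] (Ω : Finset α) (n : ℕ) (hn : Ω.card = n)
    (f : Finset α → ℝ)
    (hmono : ∀ A B : Finset α, A ⊆ B → B ⊆ Ω → f A ≤ f B)
    (hsub : ∀ A B : Finset α, A ⊆ B → B ⊆ Ω → ∀ x ∈ Ω, x ∉ B →
      f (insert x A) - f A ≥ f (insert x B) - f B)
    (k : ℕ) (hk : 1 ≤ k)
    (Sstar : Finset α) (hSstarsub : Sstar ⊆ Ω) (hSstarcard : Sstar.card ≤ k)
    (S : Finset α) (hS : S ⊆ Ω)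
    (ε : ℝ) (hε : ε ∈ Set.Ioo (0 : ℝ) 1)
    (s : ℕ) (hs : 1 ≤ s)
    (hslow : ((n : ℝ) - S.card) * Real.log (1 / ε) / k ≤ s)
    (hshigh : (s : ℝ) ≤ (n : ℝ) - S.card) :
    (1 / (((Ω \ S).powersetCard s).card : ℝ)) *
        ∑ A ∈ ((Ω \ S).powersetCard s).attach,
          A.1.sup' (Finset.card_pos.mp (by
              rw [(Finset.mem_powersetCard.mp A.2).2]; exact hs))
            (fun a => f (insert a S))
      - f S ≥ ((1 - ε) / k) * (f Sstar - f S) := by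
  obtain ⟨hε0, hε1⟩ := hε
  have hUcard : (((Ω \ S).card : ℕ) : ℝ) = (n : ℝ) - S.card := by
    rw [Finset.card_sdiff_of_subset hS, hn,
      Nat.cast_sub (hn ▸ Finset.card_le_card hS)]
  rw [← hUcard] at hslow hshigh
  have hsN : s ≤ (Ω \ S).card := by exact_mod_cast hshigh
  set U := Ω \ S with hU
  set T := Sstar \ S with hT
  have hTU : T ⊆ U := Finset.sdiff_subset_sdiff hSstarsub subset_rfl
  set g : α → ℝ := fun a => f (insert a S) - f S with hg
  have hg0 : ∀ a ∈ U, 0 ≤ g a := fun a ha => sub_nonneg.mpr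
    (hmono _ _ (Finset.subset_insert a S)
      (Finset.insert_subset (Finset.mem_sdiff.mp ha).1 hS))
  have hgain : f Sstar - f S ≤ ∑ a ∈ T, g a := by
    have h1 := sub_le_sum_marginal hsub hS T hTU
    have h2 := hmono Sstar (T ∪ S) (by rw [hT, Finset.sdiff_union_self_eq_union]
                                       exact Finset.subset_union_left)
      (Finset.union_subset (hTU.trans Finset.sdiff_subset) hS)
    linarith
  have hkR : (0 : ℝ) < k := by exact_mod_cast hk
  have hNpos : 0 < U.card := hs.trans hsN
  have hNR : (0 : ℝ) < U.card := by exact_mod_cast hNpos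
  have hC : (0 : ℝ) < U.card.choose s := by exact_mod_cast Nat.choose_pos hsN
  have hmax : ∀ (A : Finset α) (hA : A ∈ U.powersetCard s) (hne : A.Nonempty),
      f S + ((A ∩ T).card : ℝ)⁻¹ * ∑ a ∈ A ∩ T, g a ≤ A.sup' hne (fun a => f (insert a S)) := by
    intro A hA hne
    have hle : ∀ a ∈ A, g a ≤ A.sup' hne (fun a => f (insert a S)) - f S := fun a ha =>
      sub_le_sub_right (Finset.le_sup' (fun a => f (insert a S)) ha) _
    have hsum := Finset.sum_le_card_nsmul (A ∩ T) g _
      fun a ha => hle a (Finset.mem_inter.mp ha).1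
    rw [nsmul_eq_mul] at hsum
    have hnonneg : 0 ≤ A.sup' hne (fun a => f (insert a S)) - f S := by
      obtain ⟨a, ha⟩ := hne
      exact (hg0 a ((Finset.mem_powersetCard.mp hA).1 ha)).trans (hle a ha)
    have h := inv_mul_le_of_le_mul₀ (Nat.cast_nonneg _) hnonneg hsum
    linarith
  have hexpect : f S + (U.card.choose s : ℝ)⁻¹ *
      ∑ A ∈ U.powersetCard s, ((A ∩ T).card : ℝ)⁻¹ * ∑ a ∈ A ∩ T, g a ≤
      (1 / ((U.powersetCard s).card : ℝ)) * ∑ A ∈ (U.powersetCard s).attach,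
          A.1.sup' (Finset.card_pos.mp (by
              rw [(Finset.mem_powersetCard.mp A.2).2]; exact hs))
            (fun a => f (insert a S)) := by
    rw [Finset.card_powersetCard, one_div]
    calc _ = (U.card.choose s : ℝ)⁻¹ * ∑ A ∈ (U.powersetCard s).attach,
          (f S + ((A.1 ∩ T).card : ℝ)⁻¹ * ∑ a ∈ A.1 ∩ T, g a) := by
            rw [Finset.sum_attach (U.powersetCard s)
              (fun A => f S + ((A ∩ T).card : ℝ)⁻¹ * ∑ a ∈ A ∩ T, g a),
              Finset.sum_add_distrib, Finset.sum_const, Finset.card_powersetCard,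
              nsmul_eq_mul, mul_add, inv_mul_cancel_left₀ hC.ne']
      _ ≤ _ := by
            refine mul_le_mul_of_nonneg_left ?_ (inv_nonneg.mpr hC.le)
            exact Finset.sum_le_sum fun A _ => hmax A.1 A.2 _
  have hgT : 0 ≤ ∑ a ∈ T, g a := Finset.sum_nonneg fun a ha => hg0 a (hTU ha)
  have hcoef : 0 ≤ (1 - ε) / k := div_nonneg (by linarith) hkR.le
  have hmain : (1 - ε) / k * ∑ a ∈ T, g a ≤ (U.card.choose s : ℝ)⁻¹ *
      ∑ A ∈ U.powersetCard s, ((A ∩ T).card : ℝ)⁻¹ * ∑ a ∈ A ∩ T, g a := by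
    rcases T.eq_empty_or_nonempty with hT0 | hT0
    · simp [hT0]
    have htR : (0 : ℝ) < T.card := by exact_mod_cast hT0.card_pos
    have htk : (T.card : ℝ) ≤ k := by
      exact_mod_cast (Finset.card_le_card Finset.sdiff_subset).trans hSstarcard
    have hlog : Real.log (1 / ε) ≤ s * k / U.card := by
      rw [div_le_iff₀ hkR] at hslow
      rw [le_div_iff₀ hNR]
      linarith
    have hmiss : ((U.card - T.card).choose s : ℝ) ≤
        (1 - T.card / k * (1 - ε)) * U.card.choose s := by
      refine (choose_sub_le_exp_mul_choose hNpos (Finset.card_le_card hTU) s).trans ?_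
      refine mul_le_mul_of_nonneg_right ?_ hC.le
      have hexponent : (T.card * s / U.card : ℝ) = T.card / k * (s * k / U.card) := by
        field_simp
      rw [hexponent]
      exact exp_neg_mul_le hε0 hlog (div_nonneg htR.le hkR.le) ((div_le_one hkR).mpr htk)
    have havg := card_mul_sum_average_inter hTU s g
    rw [← div_eq_inv_mul, le_div_iff₀ hC]
    refine le_of_mul_le_mul_left ?_ htR
    rw [havg]
    calc _ = (T.card / k * (1 - ε) * U.card.choose s) * ∑ a ∈ T, g a := by ring
      _ ≤ _ := mul_le_mul_of_nonneg_right (by linarith) hgT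
  have hfinal := mul_le_mul_of_nonneg_left hgain hcoef
  linarith
end

section
/- Let k ≥ 1 be an integer, ε ∈ [0,1], r ≥ 0, V ≥ 0, and let x : ℕ → ℝ satisfy x(0) = 0 and x(i) − x(i−1) ≥ ((1−ε)/k)·( V − x(i−1) ) − 2r for every i ∈ {1, …, k}. Then x(k) ≥ (1 − exp(−(1−ε)))·V − 2kr. -/
/-- A sequence contracting by a factor `q ∈ [0, 1]` up to an additive error `c ≥ 0` at each of its
first `k` steps is bounded by geometric decay plus the accumulated errors. -/
theorem le_pow_mul_add_of_contraction {k : ℕ} {q c : ℝ} (hq0 : 0 ≤ q) (hq1 : q ≤ 1) (hc : 0 ≤ c)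
    {u : ℕ → ℝ} (h : ∀ i < k, u (i + 1) ≤ q * u i + c) :
    ∀ i ≤ k, u i ≤ q ^ i * u 0 + i * c := by
  intro i
  induction i with
  | zero => simp
  | succ i ih =>
    intro hi
    have hic : q * (i * c) ≤ i * c := mul_le_of_le_one_left (by positivity) hq1
    calc u (i + 1) ≤ q * u i + c := h i hi
      _ ≤ q * (q ^ i * u 0 + i * c) + c := by gcongr; exact ih (by omega)
      _ = q ^ (i + 1) * u 0 + q * (i * c) + c := by ring
      _ ≤ q ^ (i + 1) * u 0 + (i + 1 : ℕ) * c := by push_cast; linarith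

/-- intermediate bound inside Corollary 1. If `x 0 = 0` and
`x i − x (i−1) ≥ ((1−ε)/k)·(V − x (i−1)) − 2r` for `i ∈ {1, …, k}`, with `k ≥ 1`,
`ε ∈ [0,1]`, `r ≥ 0`, `V ≥ 0`, then `x k ≥ (1 − exp(−(1−ε)))·V − 2kr`. -/
theorem stmt7 (k : ℕ) (hk : 1 ≤ k) (ε r V : ℝ)
    (hε : ε ∈ Set.Icc (0 : ℝ) 1) (hr : 0 ≤ r) (hV : 0 ≤ V)
    (x : ℕ → ℝ) (hx0 : x 0 = 0)
    (hrec : ∀ i : ℕ, 1 ≤ i → i ≤ k →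
      x i - x (i - 1) ≥ ((1 - ε) / k) * (V - x (i - 1)) - 2 * r) :
    x k ≥ (1 - Real.exp (-(1 - ε))) * V - 2 * k * r := by
  obtain ⟨hε0, hε1⟩ := hε
  have hk1 : (1 : ℝ) ≤ k := by exact_mod_cast hk
  have hk0 : (0 : ℝ) < k := by linarith
  have ha0 : 0 ≤ (1 - ε) / k := div_nonneg (by linarith) hk0.le
  have ha1 : (1 - ε) / k ≤ 1 := (div_le_one hk0).2 (by linarith)
  have hgap := le_pow_mul_add_of_contraction (k := k) (q := 1 - (1 - ε) / k) (c := 2 * r)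
    (u := fun i => V - x i) (by linarith) (by linarith) (by linarith)
    (fun i hi => by
      have := hrec (i + 1) (by omega) hi
      simp only [Nat.add_sub_cancel] at this
      linarith) k le_rfl
  have hexp : (1 - (1 - ε) / k) ^ k ≤ Real.exp (-(1 - ε)) :=
    Real.one_sub_div_pow_le_exp_neg (by linarith)
  have hmul := mul_le_mul_of_nonneg_right hexp hV
  simp only [hx0, sub_zero] at hgap
  linarith
end

section
/- Let k ≥ 1 be an integer, ε ∈ [0,1], r ≥ 0, V ∈ [0,1], and let x : ℕ → ℝ satisfy x(0) = 0 and x(i) − x(i−1) ≥ ((1−ε)/k)·( V − x(i−1) ) − 2r for every i ∈ {1, …, k}. Then x(k) ≥ (1 − 1/e)·V − (ε + 2kr). -/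
/-- A discrete Grönwall bound for a contraction factor `a ∈ [0,1]` and additive error `c`. -/
theorem le_pow_mul_add_of_le_mul_add {a c : ℝ} (ha0 : 0 ≤ a) (ha1 : a ≤ 1) (hc : 0 ≤ c)
    (d : ℕ → ℝ) (n : ℕ) (h : ∀ i < n, d (i + 1) ≤ a * d i + c) :
    d n ≤ a ^ n * d 0 + n * c := by
  induction n with
  | zero => simp
  | succ n ih =>
    have h1 := mul_le_mul_of_nonneg_left (ih fun i hi => h i (by omega)) ha0
    have h2 : a * (n * c) ≤ n * c := mul_le_of_le_one_left (by positivity) ha1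
    have h3 := h n n.lt_succ_self
    push_cast
    rw [pow_succ]
    linarith

theorem Real.exp_sub_one_le_inv_exp_add {t : ℝ} (ht : t ∈ Set.Icc (0 : ℝ) 1) :
    Real.exp (t - 1) ≤ 1 / Real.exp 1 + t := by
  have h1 : Real.exp (t - 1) ≤ 1 := Real.exp_le_one_iff.2 (by linarith [ht.2])
  have h2 : Real.exp (t - 1) * Real.exp (-t) = 1 / Real.exp 1 := by
    rw [← Real.exp_add, one_div, ← Real.exp_neg]
    ring_nf
  have h3 := mul_le_mul_of_nonneg_left (Real.add_one_le_exp (-t)) (Real.exp_pos (t - 1)).le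
  have h4 := mul_le_mul_of_nonneg_right h1 ht.1
  linarith

/-- Corollary 1 of the paper. If `x 0 = 0` and
`x i − x (i−1) ≥ ((1−ε)/k)·(V − x (i−1)) − 2r` for `i ∈ {1, …, k}`, with `k ≥ 1`,
`ε ∈ [0,1]`, `r ≥ 0`, `V ∈ [0,1]`, then `x k ≥ (1 − 1/e)·V − (ε + 2kr)`. -/
theorem stmt8 (k : ℕ) (hk : 1 ≤ k) (ε r V : ℝ)
    (hε : ε ∈ Set.Icc (0 : ℝ) 1) (hr : 0 ≤ r) (hV : V ∈ Set.Icc (0 : ℝ) 1)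
    (x : ℕ → ℝ) (hx0 : x 0 = 0)
    (hrec : ∀ i : ℕ, 1 ≤ i → i ≤ k →
      x i - x (i - 1) ≥ ((1 - ε) / k) * (V - x (i - 1)) - 2 * r) :
    x k ≥ (1 - 1 / Real.exp 1) * V - (ε + 2 * k * r) := by
  have hk1 : (1 : ℝ) ≤ k := by exact_mod_cast hk
  have hq0 : 0 ≤ (1 - ε) / k := div_nonneg (by linarith [hε.2]) (by linarith)
  have hq1 : (1 - ε) / k ≤ 1 := (div_le_one (by linarith)).2 (by linarith [hε.1])
  have hgap := le_pow_mul_add_of_le_mul_add (a := 1 - (1 - ε) / k) (c := 2 * r)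
    (by linarith) (by linarith) (by linarith) (fun i => V - x i) k fun i hi => by
      have h := hrec (i + 1) (by omega) hi
      rw [Nat.add_sub_cancel] at h
      linarith
  have hpow : (1 - (1 - ε) / k) ^ k ≤ Real.exp (ε - 1) := by
    simpa using Real.one_sub_div_pow_le_exp_neg (n := k) (t := 1 - ε) (by linarith [hε.1])
  have hmul := mul_le_mul_of_nonneg_right
    (hpow.trans (Real.exp_sub_one_le_inv_exp_add hε)) hV.1
  have hεV : ε * V ≤ ε := mul_le_of_le_one_right hε.1 hV.2
  simp only [hx0, sub_zero] at hgap
  linarith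
end
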